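/- arXiv:1411.1620 — 2 statements merged into one kernel-verified Lean document; each statement's English description precedes it below -/
import Mathlib

section
/- Let n ≥ 1, let 0 < ε < 1/2, and let f : 𝕋ⁿ → ℝ be 1-Lipschitz with respect to the supremum metric dist_∞ on the n-dimensional torus. Assume that ∫_{𝕋ⁿ} ∑_{i=0}^{n−1} (2^{i²+i} / (2^i · ε^{i+1})) · |∂f/∂x_{i+1}| ≤ 1, where the partial derivatives exist almost everywhere by Rademacher's theorem, the integral is with respect to the uniform probability measure on 𝕋ⁿ, and 2^i is the i-dimensional volume of the unit ℓ_∞-ball [−1,1]^i. Then osc(f; 𝕋ⁿ) = sup f − inf f < 8ε. -/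
noncomputable section
open MeasureTheory ENNReal Filter
open scoped Classical

/-- The `n`-dimensional torus `𝕋ⁿ = ℝⁿ/ℤⁿ`; its `volume` (coming from the product of the
Haar probability measures on the circles `ℝ/ℤ`) is the uniform probability measure. -/
abbrev Torus (n : ℕ) : Type := Fin n → AddCircle (1 : ℝ)

/-- The metric `dist_p` on `𝕋ⁿ`: `dist_p(x,y) = (∑ᵢ dist(xᵢ,yᵢ)^p)^(1/p)`. -/
def distPFin {n : ℕ} (p : ℝ) (x y : Torus n) : ℝ :=
  (∑ i, dist (x i) (y i) ^ p) ^ (1 / p)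

/-- The partial derivative `∂f/∂x_i` of `f : 𝕋ⁿ → ℝ` along the `i`-th coordinate circle
at `x` (defined almost everywhere by Rademacher's theorem; junk value `0` elsewhere). -/
def pderivFin {n : ℕ} (f : Torus n → ℝ) (i : Fin n) (x : Torus n) : ℝ :=
  deriv (fun t : ℝ => f (Function.update x i (x i + (t : AddCircle (1 : ℝ))))) 0

/-- `ω_{i,p}`: the `i`-dimensional Lebesgue volume of the unit `ℓ_p`-ball in `ℝⁱ`
(equal to `1` when `i = 0`). -/
def lpBallVolume (i : ℕ) (p : ℝ) : ℝ :=
  (volume {x : Fin i → ℝ | ∑ j, |x j| ^ p ≤ 1}).toReal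

/-- The supremum metric on `𝕋ⁿ`: `dist_∞(x,y) = maxᵢ dist(xᵢ,yᵢ)`. -/
def distInftyFin {n : ℕ} (x y : Torus n) : ℝ := ⨆ i, dist (x i) (y i)

theorem lintegral_torus_succ {n : ℕ} (F : Torus (n + 1) → ℝ≥0∞) :
    ∫⁻ x, F x = ∫⁻ p : AddCircle (1 : ℝ) × Torus n,
      F (Fin.snoc (α := fun _ => AddCircle (1 : ℝ)) p.2 p.1) := by
  have h := (volume_preserving_piFinSuccAbove
    (fun _ : Fin (n + 1) => AddCircle (1 : ℝ)) (Fin.last n)).symm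
  rw [← h.lintegral_comp_emb (MeasurableEquiv.measurableEmbedding _)]
  refine lintegral_congr fun p => congrArg F ?_
  exact Fin.insertNth_last' p.1 p.2

theorem measurable_pderivFin {n : ℕ} {f : Torus n → ℝ} (hf : Continuous f) (i : Fin n) :
    Measurable (pderivFin f i) := by
  have hc : Continuous (Function.uncurry fun (x : Torus n) (t : ℝ) =>
      f (Function.update x i (x i + (t : AddCircle (1 : ℝ))))) := by
    refine hf.comp (continuous_fst.update i ?_)
    exact ((continuous_apply i).comp continuous_fst).add
      ((AddCircle.continuous_mk' (1 : ℝ)).comp continuous_snd)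
  exact (measurable_deriv_with_param hc).comp (measurable_id.prodMk measurable_const)

theorem pderivFin_comp_snoc {n : ℕ} (f : Torus (n + 1) → ℝ) (u : AddCircle (1 : ℝ))
    (i : Fin n) (y : Torus n) :
    pderivFin (fun z : Torus n => f (Fin.snoc (α := fun _ => AddCircle (1 : ℝ)) z u)) i y =
      pderivFin f i.castSucc (Fin.snoc (α := fun _ => AddCircle (1 : ℝ)) y u) := by
  simp only [pderivFin, Fin.snoc_update, Fin.snoc_castSucc]

theorem pderivFin_last_snoc {n : ℕ} (f : Torus (n + 1) → ℝ) (u : AddCircle (1 : ℝ))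
    (y : Torus n) :
    pderivFin f (Fin.last n) (Fin.snoc (α := fun _ => AddCircle (1 : ℝ)) y u) =
      deriv (fun t : ℝ =>
        f (Fin.snoc (α := fun _ => AddCircle (1 : ℝ)) y (u + (t : AddCircle (1 : ℝ))))) 0 := by
  simp only [pderivFin, Fin.update_snoc_last, Fin.snoc_last]

theorem dist_snoc_left {n : ℕ} (y z : Torus n) (u : AddCircle (1 : ℝ)) :
    dist (Fin.snoc (α := fun _ => AddCircle (1 : ℝ)) y u : Torus (n + 1))
      (Fin.snoc (α := fun _ => AddCircle (1 : ℝ)) z u) ≤ dist y z := by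
  refine (dist_pi_le_iff dist_nonneg).2 fun i => ?_
  induction i using Fin.lastCases with
  | last => simp
  | cast i => simpa using dist_le_pi_dist y z i

theorem dist_snoc_right {n : ℕ} (y : Torus n) (u v : AddCircle (1 : ℝ)) :
    dist (Fin.snoc (α := fun _ => AddCircle (1 : ℝ)) y u : Torus (n + 1))
      (Fin.snoc (α := fun _ => AddCircle (1 : ℝ)) y v) ≤ dist u v := by
  refine (dist_pi_le_iff dist_nonneg).2 fun i => ?_
  induction i using Fin.lastCases with
  | last => simp
  | cast i => simp

theorem lipschitzWith_comp_snoc {n : ℕ} {f : Torus (n + 1) → ℝ} (hf : LipschitzWith 1 f)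
    (u : AddCircle (1 : ℝ)) : LipschitzWith 1
      (fun z : Torus n => f (Fin.snoc (α := fun _ => AddCircle (1 : ℝ)) z u)) :=
  LipschitzWith.mk_one fun y z => (hf.dist_le_mul _ _).trans (by
    simpa using dist_snoc_left y z u)

theorem abs_sub_le_lintegral_deriv {g : AddCircle (1 : ℝ) → ℝ} (hg : LipschitzWith 1 g)
    (s t : AddCircle (1 : ℝ)) :
    ENNReal.ofReal |g s - g t| ≤ ∫⁻ u : AddCircle (1 : ℝ),
      ENNReal.ofReal |deriv (fun τ : ℝ => g (u + (τ : AddCircle (1 : ℝ)))) 0| := by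
  obtain ⟨a, rfl⟩ := QuotientAddGroup.mk_surjective s
  obtain ⟨b, hb, rfl⟩ : ∃ b ∈ Set.Ico a (a + 1), (b : AddCircle (1 : ℝ)) = t := by
    have h := AddCircle.coe_image_Ico_eq (1 : ℝ) a
    have ht : t ∈ Set.univ := Set.mem_univ t
    rw [← h] at ht
    exact ht
  set G : ℝ → ℝ := fun τ => g (τ : AddCircle (1 : ℝ)) with hG
  have hGlip : LipschitzWith 1 G := LipschitzWith.mk_one fun x y => by
    refine (hg.dist_le_mul _ _).trans ?_
    rw [NNReal.coe_one, one_mul, dist_eq_norm, dist_eq_norm, ← AddCircle.coe_sub]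
    exact QuotientAddGroup.norm_mk_le_norm
  have hderiv (x : ℝ) :
      deriv (fun τ : ℝ => g ((x : AddCircle (1 : ℝ)) + (τ : AddCircle (1 : ℝ)))) 0 =
        deriv G x := by
    have h := deriv_comp_const_add G x 0
    simpa [hG, AddCircle.coe_add] using h
  have hftc := (hGlip.lipschitzOnWith (s := Set.uIcc a b)).absolutelyContinuousOnInterval
    |>.integral_deriv_eq_sub
  rw [← AddCircle.lintegral_preimage (1 : ℝ) a]
  calc ENNReal.ofReal |g (a : AddCircle (1 : ℝ)) - g (b : AddCircle (1 : ℝ))|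
      = ‖∫ x in a..b, deriv G x‖ₑ := by
        rw [hftc, ← ofReal_norm, Real.norm_eq_abs, abs_sub_comm]
    _ ≤ ∫⁻ x in Set.Ioc a b, ‖deriv G x‖ₑ := by
        rw [intervalIntegral.integral_of_le hb.1]
        exact enorm_integral_le_lintegral_enorm _
    _ ≤ ∫⁻ x in Set.Ioc a (a + 1), ‖deriv G x‖ₑ :=
        lintegral_mono_set (Set.Ioc_subset_Ioc_right hb.2.le)
    _ = _ := lintegral_congr fun x => by
        rw [hderiv, ← ofReal_norm, Real.norm_eq_abs]

theorem volume_torus_closedBall {n : ℕ} (y : Torus n) {r : ℝ} (hr : 0 ≤ r) (hr' : r ≤ 1 / 2) :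
    volume (Metric.closedBall y r) = ENNReal.ofReal ((2 * r) ^ n) := by
  rw [volume_pi_closedBall _ hr]
  simp only [AddCircle.volume_closedBall, Finset.prod_const, Finset.card_univ, Fintype.card_fin]
  rw [min_eq_right (by linarith), ENNReal.ofReal_pow (by linarith)]

/-- A large jump along one fibre of the last coordinate forces, by the Lipschitz property, jumps
along all fibres over a ball. -/
theorem fibre_jump_le_lintegral_pderivFin {n : ℕ} {f : Torus (n + 1) → ℝ}
    (hf : LipschitzWith 1 f) (y : Torus n) (s t : AddCircle (1 : ℝ)) {r : ℝ} (hr : 0 ≤ r)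
    (hr' : r ≤ 1 / 2) :
    ENNReal.ofReal ((|f (Fin.snoc (α := fun _ => AddCircle (1 : ℝ)) y s) -
        f (Fin.snoc (α := fun _ => AddCircle (1 : ℝ)) y t)| - 2 * r) * (2 * r) ^ n) ≤
      ∫⁻ x, ENNReal.ofReal |pderivFin f (Fin.last n) x| := by
  have hm : Measurable fun p : AddCircle (1 : ℝ) × Torus n => ENNReal.ofReal
      |pderivFin f (Fin.last n) (Fin.snoc (α := fun _ => AddCircle (1 : ℝ)) p.2 p.1)| := by
    have h1 : Measurable fun p : AddCircle (1 : ℝ) × Torus n =>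
        (Fin.snoc (α := fun _ => AddCircle (1 : ℝ)) p.2 p.1 : Torus (n + 1)) :=
      (continuous_snd.finSnoc continuous_fst).measurable
    exact (((measurable_pderivFin hf.continuous _).comp h1).norm).ennreal_ofReal
  rw [lintegral_torus_succ, Measure.volume_eq_prod, lintegral_prod_symm' _ hm,
    ENNReal.ofReal_mul' (by positivity), ← volume_torus_closedBall y hr hr',
    ← setLIntegral_const]
  refine (setLIntegral_mono' Metric.isClosed_closedBall.measurableSet fun z hz => ?_).trans
    (setLIntegral_le_lintegral (Metric.closedBall y r) _)
  have hg : LipschitzWith 1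
      (fun u => f (Fin.snoc (α := fun _ => AddCircle (1 : ℝ)) z u)) :=
    LipschitzWith.mk_one fun u v => (hf.dist_le_mul _ _).trans (by
      simpa using dist_snoc_right z u v)
  simp only [pderivFin_last_snoc]
  refine le_trans (ENNReal.ofReal_le_ofReal ?_) (abs_sub_le_lintegral_deriv hg s t)
  have h (u : AddCircle (1 : ℝ)) : |f (Fin.snoc (α := fun _ => AddCircle (1 : ℝ)) y u) -
      f (Fin.snoc (α := fun _ => AddCircle (1 : ℝ)) z u)| ≤ r := by
    have := (lipschitzWith_comp_snoc hf u).dist_le_mul y z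
    rw [Real.dist_eq, NNReal.coe_one, one_mul, dist_comm y z] at this
    exact this.trans hz
  have hs := abs_le.1 (h s)
  have ht := abs_le.1 (h t)
  rw [sub_le_iff_le_add, abs_le]
  have := le_abs_self (f (Fin.snoc (α := fun _ => AddCircle (1 : ℝ)) z s) -
    f (Fin.snoc (α := fun _ => AddCircle (1 : ℝ)) z t))
  have := neg_abs_le (f (Fin.snoc (α := fun _ => AddCircle (1 : ℝ)) z s) -
    f (Fin.snoc (α := fun _ => AddCircle (1 : ℝ)) z t))
  constructor <;> linarith

/-- The weighted total variation controlled in the hypothesis of the Morrey-type inequality. -/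
def weightedVariation {n : ℕ} (ε : ℝ) (f : Torus n → ℝ) : ℝ≥0∞ :=
  ∫⁻ x : Torus n, ∑ i : Fin n,
    ENNReal.ofReal ((2 : ℝ) ^ (i.1 ^ 2 + i.1) / (2 ^ i.1 * ε ^ (i.1 + 1)))
      * ENNReal.ofReal |pderivFin f i x|

theorem exists_weightedVariation_slice_le {n : ℕ} (ε : ℝ) {f : Torus (n + 1) → ℝ}
    (hf : LipschitzWith 1 f) : ∃ u : AddCircle (1 : ℝ), weightedVariation ε
      (fun z : Torus n => f (Fin.snoc (α := fun _ => AddCircle (1 : ℝ)) z u)) ≤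
        weightedVariation ε f := by
  have hm : Measurable fun p : AddCircle (1 : ℝ) × Torus n => ∑ i : Fin n,
      ENNReal.ofReal ((2 : ℝ) ^ (i.1 ^ 2 + i.1) / (2 ^ i.1 * ε ^ (i.1 + 1)))
        * ENNReal.ofReal |pderivFin f i.castSucc
          (Fin.snoc (α := fun _ => AddCircle (1 : ℝ)) p.2 p.1)| := by
    have h1 : Measurable fun p : AddCircle (1 : ℝ) × Torus n =>
        (Fin.snoc (α := fun _ => AddCircle (1 : ℝ)) p.2 p.1 : Torus (n + 1)) :=
      (continuous_snd.finSnoc continuous_fst).measurable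
    exact Finset.measurable_sum _ fun i _ =>
      (((measurable_pderivFin hf.continuous i.castSucc).comp h1).norm.ennreal_ofReal).const_mul _
  have : IsProbabilityMeasure (volume : Measure (AddCircle (1 : ℝ))) :=
    ⟨by simp [AddCircle.measure_univ]⟩
  obtain ⟨u, hu⟩ := exists_le_lintegral (μ := (volume : Measure (AddCircle (1 : ℝ))))
    (hm.lintegral_prod_right' (ν := (volume : Measure (Torus n)))).aemeasurable
  refine ⟨u, ?_⟩
  simp only [weightedVariation, pderivFin_comp_snoc]
  refine hu.trans ?_
  rw [lintegral_torus_succ, Measure.volume_eq_prod, ← lintegral_prod _ hm.aemeasurable]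
  refine lintegral_mono fun p => ?_
  rw [Fin.sum_univ_castSucc]
  exact le_self_add

theorem lintegral_pderivFin_last_le {n : ℕ} {ε : ℝ} (hε : 0 < ε) {f : Torus (n + 1) → ℝ}
    (hf : Continuous f) (h : weightedVariation ε f ≤ 1) :
    ∫⁻ x, ENNReal.ofReal |pderivFin f (Fin.last n) x| ≤
      ENNReal.ofReal (ε ^ (n + 1) / 2 ^ n ^ 2) := by
  set w : ℝ := (2 : ℝ) ^ (n ^ 2 + n) / (2 ^ n * ε ^ (n + 1)) with hw
  have hwpos : 0 < w := by positivity
  have h1 : ENNReal.ofReal w * ∫⁻ x, ENNReal.ofReal |pderivFin f (Fin.last n) x| ≤ 1 := by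
    have hm : Measurable fun x => ENNReal.ofReal |pderivFin f (Fin.last n) x| :=
      (measurable_pderivFin hf _).norm.ennreal_ofReal
    rw [← lintegral_const_mul _ hm]
    refine le_trans (lintegral_mono fun x => ?_) h
    rw [Fin.sum_univ_castSucc]
    exact le_add_self
  have h2 : ε ^ (n + 1) / 2 ^ n ^ 2 = w⁻¹ := by
    rw [hw, pow_add (2 : ℝ)]
    field_simp
  rw [h2, ENNReal.ofReal_inv_of_pos hwpos, ENNReal.le_inv_iff_mul_le, mul_comm]
  exact h1

theorem fibre_jump_le {n : ℕ} {ε : ℝ} (hε : 0 < ε) {f : Torus (n + 1) → ℝ}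
    (hf : LipschitzWith 1 f) (h : weightedVariation ε f ≤ 1) (y : Torus n)
    (s t : AddCircle (1 : ℝ)) {r : ℝ} (hr : 0 ≤ r) (hr' : r ≤ 1 / 2) :
    (|f (Fin.snoc (α := fun _ => AddCircle (1 : ℝ)) y s) -
        f (Fin.snoc (α := fun _ => AddCircle (1 : ℝ)) y t)| - 2 * r) * (2 * r) ^ n ≤
      ε ^ (n + 1) / 2 ^ n ^ 2 :=
  (ENNReal.ofReal_le_ofReal_iff (by positivity)).1 <|
    (fibre_jump_le_lintegral_pderivFin hf y s t hr hr').trans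
      (lintegral_pderivFin_last_le hε hf.continuous h)

theorem half_fibre_jump_pow_le {n : ℕ} {ε : ℝ} (hε : 0 < ε) {f : Torus (n + 1) → ℝ}
    (hf : LipschitzWith 1 f) (h : weightedVariation ε f ≤ 1) (y : Torus n)
    (s t : AddCircle (1 : ℝ)) :
    (|f (Fin.snoc (α := fun _ => AddCircle (1 : ℝ)) y s) -
        f (Fin.snoc (α := fun _ => AddCircle (1 : ℝ)) y t)| / 2) ^ (n + 1) ≤
      ε ^ (n + 1) / 2 ^ n ^ 2 := by
  set δ := |f (Fin.snoc (α := fun _ => AddCircle (1 : ℝ)) y s) -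
        f (Fin.snoc (α := fun _ => AddCircle (1 : ℝ)) y t)| with hδ
  have h0 : 0 ≤ δ := abs_nonneg _
  have h1 : δ ≤ 1 / 2 := by
    have h2 := (hf.dist_le_mul (Fin.snoc (α := fun _ => AddCircle (1 : ℝ)) y s)
      (Fin.snoc (α := fun _ => AddCircle (1 : ℝ)) y t))
    rw [NNReal.coe_one, one_mul, Real.dist_eq] at h2
    refine h2.trans ((dist_snoc_right y s t).trans ?_)
    rw [dist_eq_norm]
    simpa using AddCircle.norm_le_half_period (1 : ℝ) (x := s - t) one_ne_zero
  have h3 := fibre_jump_le hε hf h y s t (r := δ / 4) (by linarith) (by linarith)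
  rw [← hδ] at h3
  calc (δ / 2) ^ (n + 1) = (δ - 2 * (δ / 4)) * (2 * (δ / 4)) ^ n := by
        rw [pow_succ, mul_comm]; ring_nf
    _ ≤ _ := h3

theorem abs_sub_le_of_slice {n : ℕ} {f : Torus (n + 1) → ℝ} {u : AddCircle (1 : ℝ)} {A B : ℝ}
    (hslice : ∀ y z : Torus n, |f (Fin.snoc (α := fun _ => AddCircle (1 : ℝ)) y u) -
      f (Fin.snoc (α := fun _ => AddCircle (1 : ℝ)) z u)| ≤ A)
    (hfibre : ∀ (y : Torus n) (s t : AddCircle (1 : ℝ)),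
      |f (Fin.snoc (α := fun _ => AddCircle (1 : ℝ)) y s) -
        f (Fin.snoc (α := fun _ => AddCircle (1 : ℝ)) y t)| ≤ B) (x x' : Torus (n + 1)) :
    |f x - f x'| ≤ A + 2 * B := by
  have h1 := hfibre (Fin.init x) (x (Fin.last n)) u
  have h2 := hslice (Fin.init x) (Fin.init x')
  have h3 := hfibre (Fin.init x') u (x' (Fin.last n))
  rw [Fin.snoc_init_self] at h1 h3
  rw [abs_le] at *
  constructor <;> linarith [h1.1, h1.2, h2.1, h2.2, h3.1, h3.2]

theorem abs_sub_le_of_weightedVariation_le_one_dim_one {ε : ℝ} (hε : 0 < ε) {f : Torus 1 → ℝ}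
    (hf : LipschitzWith 1 f) (h : weightedVariation ε f ≤ 1) (x x' : Torus 1) :
    |f x - f x'| ≤ ε := by
  have h1 := fibre_jump_le (n := 0) hε hf h (Fin.init x) (x (Fin.last 0)) (x' (Fin.last 0))
    le_rfl (by norm_num)
  rw [Subsingleton.elim (Fin.init x) (Fin.init x'), Fin.snoc_init_self,
    Subsingleton.elim (Fin.init x') (Fin.init x), Fin.snoc_init_self] at h1
  simpa using h1

theorem abs_sub_le_of_weightedVariation_le_one {ε : ℝ} (hε : 0 < ε) (n : ℕ)
    {f : Torus (n + 2) → ℝ} (hf : LipschitzWith 1 f) (h : weightedVariation ε f ≤ 1)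
    (x x' : Torus (n + 2)) : |f x - f x'| ≤ (8 - 4 / 2 ^ n) * ε := by
  induction n with
  | zero =>
    obtain ⟨u, hu⟩ := exists_weightedVariation_slice_le ε hf
    refine (abs_sub_le_of_slice (u := u) (B := 3 / 2 * ε)
      (abs_sub_le_of_weightedVariation_le_one_dim_one hε (lipschitzWith_comp_snoc hf u)
        (hu.trans h)) (fun y s t => ?_) x x').trans (by norm_num; linarith)
    have := half_fibre_jump_pow_le hε hf h y s t
    norm_num at this
    refine le_of_sq_le_sq ?_ (by positivity)
    nlinarith [sq_nonneg ε]
  | succ n ih =>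
    obtain ⟨u, hu⟩ := exists_weightedVariation_slice_le ε hf
    refine (abs_sub_le_of_slice (u := u) (B := ε / 2 ^ n)
      (ih (lipschitzWith_comp_snoc hf u) (hu.trans h)) (fun y s t => ?_) x x').trans
        (le_of_eq (by rw [pow_succ]; field_simp; ring))
    have h1 := half_fibre_jump_pow_le hε hf h y s t
    have h2 : ε ^ (n + 2 + 1) / 2 ^ (n + 2) ^ 2 ≤ (ε / 2 ^ (n + 1)) ^ (n + 2 + 1) := by
      rw [div_pow, ← pow_mul]
      gcongr
      · norm_num
      · nlinarith
    have h3 := le_of_pow_le_pow_left₀ (by omega) (by positivity) (h1.trans h2)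
    rw [pow_succ, ← div_div] at h3
    linarith

theorem distInftyFin_le_dist {n : ℕ} (x y : Torus n) : distInftyFin x y ≤ dist x y :=
  Real.iSup_le (fun i => dist_le_pi_dist x y i) dist_nonneg

/-- Morrey-type inequality, case `p = ∞`, `q = 1`. Let `n ≥ 1`,
`0 < ε < 1/2`, and let `f : 𝕋ⁿ → ℝ` be `1`-Lipschitz w.r.t. `dist_∞`. If
`∫ ∑_{i=0}^{n-1} 2^(i²+i)/(2^i ε^(i+1)) |∂f/∂x_{i+1}| ≤ 1` (integration w.r.t. the uniform
probability measure; `2^i` is the volume of the unit `ℓ_∞`-ball `[-1,1]^i`), then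
`osc(f;𝕋ⁿ) = sup f - inf f < 8ε`. (Coordinates are `0`-indexed.) -/
theorem morrey_torus_dist_infty (n : ℕ) (hn : 1 ≤ n) (ε : ℝ)
    (hε0 : 0 < ε) (hε : ε < 1 / 2) (f : Torus n → ℝ)
    (hlip : ∀ x y : Torus n, |f x - f y| ≤ distInftyFin x y)
    (hint : ∫⁻ x : Torus n, ∑ i : Fin n,
        ENNReal.ofReal ((2 : ℝ) ^ (i.1 ^ 2 + i.1) / (2 ^ i.1 * ε ^ (i.1 + 1)))
          * ENNReal.ofReal |pderivFin f i x| ≤ 1) :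
    (⨆ x, f x) - (⨅ x, f x) < 8 * ε := by
  have hf : LipschitzWith 1 f := LipschitzWith.mk_one fun x y =>
    (hlip x y).trans (distInftyFin_le_dist x y)
  have hosc : ∃ C < 8 * ε, ∀ x y, |f x - f y| ≤ C := by
    obtain _ | _ | n := n
    · omega
    · exact ⟨ε, by linarith, abs_sub_le_of_weightedVariation_le_one_dim_one hε0 hf hint⟩
    · refine ⟨(8 - 4 / 2 ^ n) * ε, ?_, abs_sub_le_of_weightedVariation_le_one hε0 n hf hint⟩
      have : (0 : ℝ) < 4 / 2 ^ n := by positivity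
      nlinarith
  obtain ⟨C, hC, h⟩ := hosc
  have h1 : (⨆ x, f x) ≤ C + ⨅ x, f x := ciSup_le fun x => by
    rw [← sub_le_iff_le_add']
    exact le_ciInf fun y => by linarith [le_abs_self (f x - f y), h x y]
  linarith
end
end

section
/- Let 1 < p < ∞, let 0 < ε < 1/2, and let f : 𝕋^∞ → ℝ be measurable and 1-Lipschitz with respect to the metric dist_p. Set q = p/(p−1) and c_{ε,p,i} = 2^{(i−1)² + q(i−1)} / (ω_{i−1,p} · ε^{i−1+q}) for i ≥ 1. Assume that ∫_{𝕋^∞} ∑_{i=1}^{∞} c_{ε,p,i} · |∂f/∂x_i|^q dσ ≤ 1/2, where ∂f/∂x_i denotes the almost-everywhere defined partial derivative of f along the i-th circle coordinate. Then the essential oscillation of f on 𝕋^∞ satisfies essosc(f; 𝕋^∞) < 8ε. -/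
noncomputable section
open MeasureTheory ENNReal Filter
open scoped Classical

/-- The infinite-dimensional torus `𝕋^∞ = (ℝ/ℤ)^ℕ`. -/
abbrev InfTorus : Type := ℕ → AddCircle (1 : ℝ)

/-- The product of the uniform probability measures on the circles `ℝ/ℤ`, realized as the
normalized Haar measure on the compact group `𝕋^∞` (by uniqueness of the translation-invariant
Borel probability measure, they coincide). -/
def torusMeasure : Measure InfTorus :=
  Measure.addHaarMeasure (⊤ : TopologicalSpace.PositiveCompacts InfTorus)

/-- The metric `dist_p` on the infinite torus, valued in `[0,∞]`:
`dist_p(x,y) = (∑ᵢ dist(xᵢ,yᵢ)^p)^(1/p)`. -/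
def distP (p : ℝ) (x y : InfTorus) : ℝ≥0∞ := (∑' i, edist (x i) (y i) ^ p) ^ (1 / p)

/-- The partial derivative `∂f/∂x_i` of `f : 𝕋^∞ → ℝ` along the `i`-th coordinate circle
at `x` (defined almost everywhere by Rademacher's theorem; junk value `0` elsewhere). -/
def pderivInf (f : InfTorus → ℝ) (i : ℕ) (x : InfTorus) : ℝ :=
  deriv (fun t : ℝ => f (Function.update x i (x i + (t : AddCircle (1 : ℝ))))) 0

/-- The essential oscillation `essosc(f;μ) = ess sup f - ess inf f`, expressed equivalently
as the `L^∞(μ × μ)`-norm of `(x,y) ↦ f x - f y`, valued in `[0,∞]`. -/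
def essOsc (μ : Measure InfTorus) (f : InfTorus → ℝ) : ℝ≥0∞ :=
  essSup (fun z : InfTorus × InfTorus => ENNReal.ofReal |f z.1 - f z.2|) (μ.prod μ)

theorem hasDerivAt_zero_of_tendsto_slope_rat {φ : ℝ → ℝ} (hφ : Continuous φ) {c : ℝ}
    (h : Tendsto (fun r : ℚ => slope φ 0 (r : ℝ))
      (comap (fun r : ℚ => (r : ℝ)) (nhdsWithin 0 {0}ᶜ)) (nhds c)) :
    HasDerivAt φ c 0 := by
  rw [hasDerivAt_iff_tendsto_slope]
  rw [(Metric.nhds_basis_closedBall).tendsto_right_iff] at h ⊢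
  intro η hη
  have h1 := h η hη
  rw [eventually_comap] at h1
  rw [eventually_nhdsWithin_iff, Metric.eventually_nhds_iff_ball] at h1 ⊢
  obtain ⟨δ, hδ, h2⟩ := h1
  refine ⟨δ, hδ, fun t ht ht0 => ?_⟩
  have hU : IsOpen (Metric.ball (0 : ℝ) δ ∩ {0}ᶜ) :=
    Metric.isOpen_ball.inter isOpen_compl_singleton
  have hd := Rat.denseRange_cast (𝕜 := ℝ)
  have hcl := hd.open_subset_closure_inter hU ⟨ht, ht0⟩
  obtain ⟨u, hu, hut⟩ := mem_closure_iff_seq_limit.1 hcl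
  have hs : ContinuousAt (slope φ 0) t := by
    rw [slope_fun_def]
    have : t - 0 ≠ 0 := by simpa using ht0
    fun_prop (disch := assumption)
  refine Metric.isClosed_closedBall.mem_of_tendsto (hs.tendsto.comp hut) (.of_forall fun n => ?_)
  obtain ⟨⟨hn1, hn2⟩, r, hr⟩ := hu n
  have := h2 (u n) hn1 hn2 r hr
  rwa [hr] at this

theorem measurable_deriv_zero_of_continuous {α : Type*} [MeasurableSpace α] {F : α → ℝ → ℝ}
    (hF : ∀ t, Measurable fun x => F x t) (hc : ∀ x, Continuous (F x)) :
    Measurable fun x => deriv (F x) 0 := by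
  let l : Filter ℚ := comap (fun r : ℚ => (r : ℝ)) (nhdsWithin 0 {0}ᶜ)
  let S : Set α := {x | ∃ c, Tendsto (fun r : ℚ => slope (F x) 0 (r : ℝ)) l (nhds c)}
  have hS : MeasurableSet S := measurableSet_exists_tendsto fun r => by
    simp only [slope_def_field]
    exact ((hF _).sub (hF _)).div_const _
  have hseq : Tendsto (fun n : ℕ => 1 / ((n : ℝ) + 1)) atTop (nhdsWithin 0 {0}ᶜ) :=
    tendsto_nhdsWithin_iff.2 ⟨tendsto_one_div_add_atTop_nhds_zero_nat,
      .of_forall fun n => by simp; positivity⟩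
  refine measurable_of_tendsto_metrizable
    (f := fun (n : ℕ) => S.indicator fun x => slope (F x) 0 (1 / ((n : ℝ) + 1)))
    (fun n => ?_) (tendsto_pi_nhds.2 fun x => ?_)
  · refine Measurable.indicator ?_ hS
    simp only [slope_def_field]
    exact ((hF _).sub (hF _)).div_const _
  · by_cases hx : x ∈ S
    · obtain ⟨c, hxc⟩ := id hx
      have hd := hasDerivAt_zero_of_tendsto_slope_rat (hc x) hxc
      simp only [Set.indicator_of_mem hx, hd.deriv]
      exact (hasDerivAt_iff_tendsto_slope.1 hd).comp hseq
    · simp only [Set.indicator_of_notMem hx]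
      rw [deriv_zero_of_not_differentiableAt]
      · exact tendsto_const_nhds
      · exact fun hd => hx ⟨_, (hasDerivAt_iff_tendsto_slope.1 hd.hasDerivAt).comp tendsto_comap⟩

theorem abs_sub_le_half_of_lintegral_deriv_rpow_le {φ : ℝ → ℝ} {q δ : ℝ} (hq : 1 ≤ q)
    (hφ : LipschitzWith 1 φ) (hper : φ 1 = φ 0) (hδ : 0 ≤ δ)
    (hint : ∫⁻ t in Set.Ioc (0 : ℝ) 1, ENNReal.ofReal |deriv φ t| ^ q ≤ ENNReal.ofReal δ ^ q)
    {s : ℝ} (hs : s ∈ Set.Icc (0 : ℝ) 1) : |φ s - φ 0| ≤ δ / 2 := by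
  have hq0 : 0 < q := by linarith
  have hm : Measurable fun t => |deriv φ t| := (measurable_deriv φ).abs
  have hbd : ∀ t, |deriv φ t| ≤ 1 := fun t => by
    simpa using norm_deriv_le_of_lipschitz (x₀ := t) hφ
  have hii : ∀ a b : ℝ, IntervalIntegrable (fun t => |deriv φ t|) volume a b := fun a b =>
    (intervalIntegrable_const (c := (1 : ℝ))).mono_fun hm.aestronglyMeasurable
      (.of_forall fun t => by simpa using hbd t)
  have hab : ∀ a b : ℝ, a ≤ b → |φ b - φ a| ≤ ∫ t in a..b, |deriv φ t| := fun a b h => by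
    have := (hφ.lipschitzOnWith (s := Set.uIcc a b)).absolutelyContinuousOnInterval
    rw [← this.integral_deriv_eq_sub]
    exact intervalIntegral.abs_integral_le_integral_abs h
  have htot : ∫ t in (0 : ℝ)..1, |deriv φ t| ≤ δ := by
    rw [intervalIntegral.integral_of_le zero_le_one,
      integral_eq_lintegral_of_nonneg_ae (.of_forall fun _ => abs_nonneg _)
        hm.aestronglyMeasurable]
    refine ENNReal.toReal_le_of_le_ofReal hδ ?_
    rw [← ENNReal.rpow_le_rpow_iff hq0]
    refine le_trans ?_ hint
    have : IsProbabilityMeasure (volume.restrict (Set.Ioc (0 : ℝ) 1)) := ⟨by simp⟩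
    have h := eLpNorm_le_eLpNorm_of_exponent_le (μ := volume.restrict (Set.Ioc (0 : ℝ) 1))
      (p := 1) (q := ENNReal.ofReal q) (by simpa using hq) (measurable_deriv φ).aestronglyMeasurable
    rw [eLpNorm_one_eq_lintegral_enorm, eLpNorm_eq_lintegral_rpow_enorm_toReal (by simpa) (by simp),
      ENNReal.toReal_ofReal hq0.le, ← ENNReal.rpow_le_rpow_iff hq0, ← ENNReal.rpow_mul,
      one_div_mul_cancel hq0.ne', ENNReal.rpow_one] at h
    simpa only [Real.enorm_eq_ofReal_abs] using h
  have h1 := hab 0 s hs.1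
  have h2 := hab s 1 hs.2
  rw [hper, abs_sub_comm] at h2
  have h3 := intervalIntegral.integral_add_adjacent_intervals (hii 0 s) (hii s 1)
  linarith

instance : IsProbabilityMeasure torusMeasure := ⟨Measure.addHaarMeasure_self⟩

instance : Measure.IsAddHaarMeasure torusMeasure :=
  inferInstanceAs (Measure.IsAddHaarMeasure (Measure.addHaarMeasure _))

instance : IsProbabilityMeasure (volume : Measure (AddCircle (1 : ℝ))) := ⟨by simp⟩

/-- The point whose first `n` coordinates are those of `y` and whose other coordinates are those
of `x`. -/
def mixCoord (n : ℕ) (y x : InfTorus) : InfTorus := fun j => if j < n then y j else x j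

theorem measurePreserving_mixCoord (n : ℕ) :
    MeasurePreserving (fun z : InfTorus × InfTorus => mixCoord n z.1 z.2)
      (torusMeasure.prod torusMeasure) torusMeasure := by
  let φ : InfTorus × InfTorus →+ InfTorus :=
    { toFun := fun z => mixCoord n z.1 z.2
      map_zero' := by ext j; simp [mixCoord]
      map_add' := fun a b => by ext j; by_cases h : j < n <;> simp [mixCoord, h] }
  have : (torusMeasure.prod torusMeasure).IsAddHaarMeasure :=
    Measure.prod.instIsAddHaarMeasure _ _
  refine φ.measurePreserving (continuous_pi fun j => ?_) (fun x => ⟨(x, x), ?_⟩) (by simp)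
  · by_cases h : j < n <;> simp only [φ, mixCoord, AddMonoidHom.coe_mk, ZeroHom.coe_mk, h,
      if_true, if_false] <;> fun_prop
  · ext j; simp [φ, mixCoord]

theorem measurePreserving_mixCoord_add_single (n : ℕ) :
    MeasurePreserving (fun z : (InfTorus × InfTorus) × AddCircle (1 : ℝ) =>
        mixCoord n z.1.2 z.1.1 + Pi.single n z.2)
      ((torusMeasure.prod torusMeasure).prod volume) torusMeasure := by
  let φ : (InfTorus × InfTorus) × AddCircle (1 : ℝ) →+ InfTorus :=
    { toFun := fun z => mixCoord n z.1.2 z.1.1 + Pi.single n z.2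
      map_zero' := by ext j; simp [mixCoord]
      map_add' := fun a b => by
        ext j
        by_cases h : j < n <;> simp [mixCoord, h, Pi.single_add] <;> abel }
  have : (torusMeasure.prod torusMeasure).IsAddHaarMeasure :=
    Measure.prod.instIsAddHaarMeasure _ _
  have : BorelSpace (InfTorus × InfTorus) := Prod.borelSpace
  have : MeasurableAdd (InfTorus × InfTorus) := ContinuousAdd.measurableAdd
  have : ((torusMeasure.prod torusMeasure).prod
      (volume : Measure (AddCircle (1 : ℝ)))).IsAddHaarMeasure :=
    Measure.prod.instIsAddHaarMeasure _ _
  have : BorelSpace ((InfTorus × InfTorus) × AddCircle (1 : ℝ)) := Prod.borelSpace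
  refine φ.measurePreserving (continuous_pi fun j => ?_) (fun x => ⟨((x, x), 0), ?_⟩) (by simp)
  · simp only [φ, mixCoord, AddMonoidHom.coe_mk, ZeroHom.coe_mk, Pi.add_apply, Pi.single_apply]
    refine .add ?_ ?_
    · split_ifs <;> fun_prop
    · split_ifs <;> fun_prop
  · ext j; simp [φ, mixCoord]

theorem measurePreserving_restrict_fin (n : ℕ) :
    MeasurePreserving (fun (x : InfTorus) (j : Fin n) => x j) torusMeasure
      (Measure.pi fun _ => volume) := by
  let φ : InfTorus →+ (Fin n → AddCircle (1 : ℝ)) :=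
    { toFun := fun x j => x j
      map_zero' := rfl
      map_add' := fun a b => rfl }
  refine φ.measurePreserving (continuous_pi fun j => continuous_apply _)
    (fun u => ⟨fun j => if h : j < n then u ⟨j, h⟩ else 0, ?_⟩) (by simp)
  ext j; simp [φ]

theorem volume_sum_rpow_le_rpow {p : ℝ} (hp : 1 < p) (n : ℕ) {r : ℝ} (hr : 0 < r) :
    volume {x : Fin n → ℝ | ∑ j, |x j| ^ p ≤ r ^ p} =
      ENNReal.ofReal (r ^ n) * ENNReal.ofReal (lpBallVolume n p) := by
  have hp0 : 0 < p := by linarith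
  have key : ∀ s : ℝ, 0 < s → {x : Fin n → ℝ | ∑ j, |x j| ^ p ≤ s ^ p} =
      {x | (∑ j, |x j| ^ p) ^ (1 / p) ≤ s} := fun s hs => by
    ext x
    have : 0 ≤ ∑ j, |x j| ^ p := Finset.sum_nonneg fun _ _ => by positivity
    simp only [Set.mem_ofPred_eq, one_div]
    rw [Real.rpow_inv_le_iff_of_pos this hs.le hp0]
  have h1 : {x : Fin n → ℝ | ∑ j, |x j| ^ p ≤ 1} = {x | (∑ j, |x j| ^ p) ^ (1 / p) ≤ 1} := by
    rw [← key 1 one_pos, Real.one_rpow]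
  rcases Nat.eq_zero_or_pos n with rfl | hn
  · have : {x : Fin 0 → ℝ | (0 : ℝ) ≤ r ^ p} = Set.univ := by
      ext; simp; positivity
    simp [lpBallVolume, this]
  · have : Nonempty (Fin n) := ⟨⟨0, hn⟩⟩
    rw [key r hr, lpBallVolume, h1, volume_sum_rpow_le _ hp.le, volume_sum_rpow_le _ hp.le,
      ENNReal.ofReal_pow hr.le, ENNReal.ofReal_toReal]
    · simp
    · simp

theorem lpBallVolume_pos {p : ℝ} (hp : 1 < p) (n : ℕ) : 0 < lpBallVolume n p := by
  have hp0 : 0 < p := by linarith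
  have h := volume_sum_rpow_le_rpow hp n one_pos
  simp only [one_pow, ENNReal.ofReal_one, one_mul, Real.one_rpow] at h
  refine ENNReal.ofReal_pos.1 (h ▸ lt_of_lt_of_le ?_ (measure_mono (?_ :
    {x : Fin n → ℝ | ∑ j, |x j| ^ p < 1} ⊆ {x | ∑ j, |x j| ^ p ≤ 1})))
  · refine IsOpen.measure_pos _ (isOpen_lt (continuous_finsetSum _ fun j _ => ?_)
      continuous_const) ⟨0, by simp [Real.zero_rpow hp0.ne']⟩
    exact (continuous_abs.comp (continuous_apply j)).rpow_const fun _ => .inr hp0.le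
  · intro x hx
    rw [Set.mem_ofPred_eq] at hx ⊢
    exact hx.le

theorem measurableSet_sum_norm_sub_rpow_le (p : ℝ) (n : ℕ) (r : ℝ) (y : InfTorus) :
    MeasurableSet {w : InfTorus | ∑ j ∈ Finset.range n, ‖w j - y j‖ ^ p ≤ r} :=
  measurableSet_le (Finset.measurable_sum _ fun j _ =>
    ((((measurable_pi_apply j).sub_const _).norm).pow_const _)) measurable_const

theorem le_torusMeasure_sum_norm_sub_rpow_le {p : ℝ} (hp : 1 < p) (n : ℕ) {r : ℝ} (hr : 0 < r)
    (hr2 : r < 1 / 2) (y : InfTorus) :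
    ENNReal.ofReal (r ^ n) * ENNReal.ofReal (lpBallVolume n p) ≤
      torusMeasure {w : InfTorus | ∑ j ∈ Finset.range n, ‖w j - y j‖ ^ p ≤ r ^ p} := by
  have hp0 : 0 < p := by linarith
  rw [← volume_sum_rpow_le_rpow hp n hr]
  have hB : MeasurableSet {u : Fin n → AddCircle (1 : ℝ) | ∑ j, ‖u j‖ ^ p ≤ r ^ p} :=
    measurableSet_le (Finset.measurable_sum _ fun j _ =>
      (((measurable_pi_apply j).norm).pow_const _)) measurable_const
  have hset : {w : InfTorus | ∑ j ∈ Finset.range n, ‖w j - y j‖ ^ p ≤ r ^ p} =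
      (fun w => w + -y) ⁻¹' ((fun (x : InfTorus) (j : Fin n) => x j) ⁻¹'
        {u | ∑ j, ‖u j‖ ^ p ≤ r ^ p}) := by
    ext w
    simp [Finset.sum_range, sub_eq_add_neg]
  rw [hset, measure_preimage_add_right, (measurePreserving_restrict_fin n).measure_preimage
    hB.nullMeasurableSet, ← (measurePreserving_pi _ _ fun _ : Fin n =>
      AddCircle.measurePreserving_mk 1 (-(1 / 2))).measure_preimage hB.nullMeasurableSet,
    ← Measure.restrict_pi_pi, Measure.restrict_apply' (.univ_pi fun _ => measurableSet_Ioc)]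
  refine measure_mono fun v hv => ⟨?_, fun j _ => ?_⟩
  · refine (Finset.sum_le_sum fun j _ => ?_).trans (show ∑ j, |v j| ^ p ≤ r ^ p from hv)
    exact Real.rpow_le_rpow (norm_nonneg _) QuotientAddGroup.norm_mk_le_norm hp0.le
  · have h1 : |v j| ^ p ≤ r ^ p :=
      (Finset.single_le_sum (f := fun j => |v j| ^ p) (fun j _ => by positivity)
        (Finset.mem_univ j)).trans hv
    rw [Real.rpow_le_rpow_iff (abs_nonneg _) hr.le hp0, abs_le] at h1
    constructor <;> linarith

theorem tendsto_eLpNorm_one_comp_sub_comp {Ω X : Type*} [MeasurableSpace Ω] [TopologicalSpace X]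
    [NormalSpace X] [MeasurableSpace X] [BorelSpace X] {τ : Measure Ω} [IsFiniteMeasure τ]
    {μ : Measure X} [μ.WeaklyRegular] {S : ℕ → Ω → X} {T : Ω → X}
    (hS : ∀ n, MeasurePreserving (S n) τ μ) (hT : MeasurePreserving T τ μ)
    (hST : ∀ z, Tendsto (fun n => S n z) atTop (nhds (T z))) {g : X → ℝ} (hg : MemLp g 1 μ) :
    Tendsto (fun n => eLpNorm (g ∘ S n - g ∘ T) 1 τ) atTop (nhds 0) := by
  have hgm := hg.aestronglyMeasurable
  rw [ENNReal.tendsto_nhds_zero]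
  intro η hη
  have hη3 : η / 3 ≠ 0 := (ENNReal.div_pos hη.ne' (by simp)).ne'
  obtain ⟨h, hh, hhm⟩ := hg.exists_boundedContinuous_eLpNorm_sub_le ENNReal.one_ne_top hη3
  have hlim : Tendsto (fun n => eLpNorm (h ∘ S n - h ∘ T) 1 τ) atTop (nhds 0) := by
    simp only [eLpNorm_one_eq_lintegral_enorm]
    have h0 : ∫⁻ _ : Ω, (0 : ℝ≥0∞) ∂τ = 0 := by simp
    rw [← h0]
    refine tendsto_lintegral_of_dominated_convergence' (fun _ => ENNReal.ofReal (2 * ‖h‖))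
      (fun n => ?_) (fun n => .of_forall fun z => ?_) ?_ (.of_forall fun z => ?_)
    · exact (((h.continuous.measurable.comp (hS n).measurable).sub
        (h.continuous.measurable.comp hT.measurable)).enorm).aemeasurable
    · simp only [Pi.sub_apply, Real.enorm_eq_ofReal_abs]
      exact ENNReal.ofReal_le_ofReal (h.dist_le_two_norm _ _)
    · rw [lintegral_const]
      exact ENNReal.mul_ne_top ENNReal.ofReal_ne_top (measure_ne_top _ _)
    · have := (((h.continuous.tendsto (T z)).comp (hST z)).sub_const (h (T z))).enorm
      simpa using this
  filter_upwards [ENNReal.tendsto_nhds_zero.1 hlim _ (pos_iff_ne_zero.2 hη3)] with n hn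
  have hsub := hgm.sub hhm.aestronglyMeasurable
  have e1 : eLpNorm ((g - ⇑h) ∘ S n) 1 τ ≤ η / 3 := by
    rwa [eLpNorm_comp_measurePreserving hsub (hS n)]
  have e2 : eLpNorm ((g - ⇑h) ∘ T) 1 τ ≤ η / 3 := by
    rwa [eLpNorm_comp_measurePreserving hsub hT]
  have m1 := hsub.comp_measurePreserving (hS n)
  have m2 := hsub.comp_measurePreserving hT
  have m3 : AEStronglyMeasurable (h ∘ S n - h ∘ T) τ :=
    (hhm.aestronglyMeasurable.comp_measurePreserving (hS n)).sub
      (hhm.aestronglyMeasurable.comp_measurePreserving hT)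
  have hdecomp : g ∘ S n - g ∘ T =
      (g - ⇑h) ∘ S n + (h ∘ S n - h ∘ T) - (g - ⇑h) ∘ T := by
    ext z
    simp
  rw [hdecomp]
  refine (eLpNorm_sub_le (m1.add m3) m2 le_rfl).trans ?_
  refine (add_le_add ((eLpNorm_add_le m1 m3 le_rfl).trans (add_le_add e1 hn)) e2).trans ?_
  exact (ENNReal.add_thirds η).le

theorem tendsto_mixCoord (y x : InfTorus) :
    Tendsto (fun n => mixCoord n y x) atTop (nhds y) :=
  tendsto_pi_nhds.2 fun j => tendsto_const_nhds.congr' <| by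
    filter_upwards [eventually_gt_atTop j] with n hn
    simp [mixCoord, hn]

theorem exists_seq_tendsto_comp_mixCoord {g : InfTorus → ℝ} (hg : MemLp g 1 torusMeasure) :
    ∃ ns : ℕ → ℕ, ∀ᵐ z ∂(torusMeasure.prod torusMeasure),
      Tendsto (fun k => g (mixCoord (ns k) z.2 z.1)) atTop (nhds (g z.2)) := by
  have hS (n : ℕ) := (measurePreserving_mixCoord n).comp
    (Measure.measurePreserving_swap (μ := torusMeasure) (ν := torusMeasure))
  have hT : MeasurePreserving (Prod.snd : InfTorus × InfTorus → InfTorus)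
      (torusMeasure.prod torusMeasure) torusMeasure := measurePreserving_snd
  have hlim := tendsto_eLpNorm_one_comp_sub_comp hS hT (fun z => tendsto_mixCoord z.2 z.1) hg
  obtain ⟨ns, -, hns⟩ := (tendstoInMeasure_of_tendsto_eLpNorm one_ne_zero
    (fun n => hg.aestronglyMeasurable.comp_measurePreserving (hS n))
    (hg.aestronglyMeasurable.comp_measurePreserving hT) hlim).exists_seq_tendsto_ae
  exact ⟨ns, hns⟩

section LipschitzDistP

variable {p : ℝ} {f : InfTorus → ℝ}

theorem abs_sub_le_of_sum_norm_sub_rpow_le (hp : 1 < p)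
    (hlip : ∀ x y : InfTorus, distP p x y ≠ ∞ → |f x - f y| ≤ (distP p x y).toReal)
    {x y : InfTorus} {s : Finset ℕ} {r : ℝ} (hr : 0 ≤ r) (heq : ∀ j ∉ s, x j = y j)
    (hs : ∑ j ∈ s, ‖x j - y j‖ ^ p ≤ r ^ p) : |f x - f y| ≤ r := by
  have hp0 : 0 < p := by linarith
  have hd : distP p x y ≤ ENNReal.ofReal r := by
    rw [distP, tsum_eq_sum (s := s) fun j hj => by simp [heq j hj, hp0], one_div,
      ENNReal.rpow_inv_le_iff hp0, ENNReal.ofReal_rpow_of_nonneg hr hp0.le]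
    refine le_trans (le_of_eq ?_) (ENNReal.ofReal_le_ofReal hs)
    rw [ENNReal.ofReal_sum_of_nonneg fun j _ => by positivity]
    refine Finset.sum_congr rfl fun j _ => ?_
    rw [edist_dist, dist_eq_norm, ENNReal.ofReal_rpow_of_nonneg (norm_nonneg _) hp0.le]
  exact (hlip x y (hd.trans_lt ENNReal.ofReal_lt_top).ne).trans
    (ENNReal.toReal_le_of_le_ofReal hr hd)

theorem lipschitzWith_update_add_coe (hp : 1 < p)
    (hlip : ∀ x y : InfTorus, distP p x y ≠ ∞ → |f x - f y| ≤ (distP p x y).toReal)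
    (x : InfTorus) (i : ℕ) :
    LipschitzWith 1 fun t : ℝ => f (Function.update x i (x i + (t : AddCircle (1 : ℝ)))) := by
  refine LipschitzWith.of_dist_le_mul fun t s => ?_
  rw [NNReal.coe_one, one_mul, Real.dist_eq]
  refine abs_sub_le_of_sum_norm_sub_rpow_le hp hlip (s := {i}) dist_nonneg (fun j hj => ?_) ?_
  · have : j ≠ i := by simpa using hj
    simp [this]
  · rw [Finset.sum_singleton, Function.update_self, Function.update_self, add_sub_add_left_eq_sub,
      ← AddCircle.coe_sub]
    exact Real.rpow_le_rpow (norm_nonneg _) QuotientAddGroup.norm_mk_le_norm (by linarith)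

theorem update_add_eq_add_single (x : InfTorus) (i : ℕ) (t : AddCircle (1 : ℝ)) :
    Function.update x i (x i + t) = x + Pi.single i t := by
  ext j
  by_cases h : j = i
  · subst h; simp
  · simp [h]

theorem aemeasurable_pderivInf (hp : 1 < p) (hmeas : AEMeasurable f torusMeasure)
    (hlip : ∀ x y : InfTorus, distP p x y ≠ ∞ → |f x - f y| ≤ (distP p x y).toReal) (i : ℕ) :
    AEMeasurable (pderivInf f i) torusMeasure := by
  refine NullMeasurable.aemeasurable ?_
  refine measurable_deriv_zero_of_continuous (α := NullMeasurableSpace InfTorus torusMeasure)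
    (F := fun x t => f (Function.update x i (x i + (t : AddCircle (1 : ℝ)))))
    (fun t => ?_) fun x => (lipschitzWith_update_add_coe hp hlip x i).continuous
  have h : AEMeasurable (fun x : InfTorus =>
      f (Function.update x i (x i + (t : AddCircle (1 : ℝ))))) torusMeasure := by
    simp only [update_add_eq_add_single]
    exact hmeas.comp_quasiMeasurePreserving
      (measurePreserving_add_right torusMeasure _).quasiMeasurePreserving
  exact h.nullMeasurable

theorem pderivInf_add_single (x : InfTorus) (i : ℕ) (t : ℝ) :
    pderivInf f i (x + Pi.single i (t : AddCircle (1 : ℝ))) =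
      deriv (fun s : ℝ => f (Function.update x i (x i + (s : AddCircle (1 : ℝ))))) t := by
  simp only [pderivInf, update_add_eq_add_single, add_assoc, ← Pi.single_add, ← AddCircle.coe_add]
  have h := deriv_comp_const_add (fun s : ℝ => f (x + Pi.single i (s : AddCircle (1 : ℝ)))) t 0
  rwa [add_zero] at h

theorem abs_sub_mixCoord_succ_le {q : ℝ} (hp : 1 < p) (hq : 1 ≤ q)
    (hlip : ∀ x y : InfTorus, distP p x y ≠ ∞ → |f x - f y| ≤ (distP p x y).toReal)
    {x y w : InfTorus} {i : ℕ} {ρ δ : ℝ} (hρ : 0 ≤ ρ) (hδ : 0 ≤ δ)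
    (hw : ∑ j ∈ Finset.range i, ‖w j - y j‖ ^ p ≤ ρ ^ p)
    (hint : ∫⁻ t : AddCircle (1 : ℝ),
      ENNReal.ofReal |pderivInf f i (mixCoord i w x + Pi.single i t)| ^ q ≤
        ENNReal.ofReal δ ^ q) :
    |f (mixCoord (i + 1) y x) - f (mixCoord i y x)| ≤ 2 * ρ + δ / 2 := by
  set z := mixCoord i w x with hz
  have hzi : z i = x i := by simp [hz, mixCoord]
  rw [← AddCircle.lintegral_preimage 1 0, zero_add] at hint
  simp only [pderivInf_add_single] at hint
  obtain ⟨s, hs, hsy⟩ := AddCircle.eq_coe_Ico (y i - x i)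
  have h := abs_sub_le_half_of_lintegral_deriv_rpow_le hq
    (lipschitzWith_update_add_coe hp hlip z i) (by simp [AddCircle.coe_period]) hδ hint
    (Set.Ico_subset_Icc_self hs)
  simp only [hsy, hzi, add_sub_cancel, AddCircle.coe_zero, add_zero] at h
  rw [← hzi, Function.update_eq_self] at h
  have h1 : |f (mixCoord (i + 1) y x) - f (Function.update z i (y i))| ≤ ρ := by
    refine abs_sub_le_of_sum_norm_sub_rpow_le hp hlip (s := Finset.range i) hρ (fun j hj => ?_) ?_
    · rw [Finset.mem_range] at hj
      rcases eq_or_ne j i with rfl | hji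
      · simp [mixCoord]
      · have : ¬ j < i + 1 := by omega
        simp [hz, mixCoord, hj, hji, this]
    · refine le_of_eq_of_le (Finset.sum_congr rfl fun j hj => ?_) hw
      rw [Finset.mem_range] at hj
      simp [hz, mixCoord, hj, hj.ne, hj.trans (Nat.lt_succ_self i), norm_sub_rev (y j)]
  have h2 : |f z - f (mixCoord i y x)| ≤ ρ := by
    refine abs_sub_le_of_sum_norm_sub_rpow_le hp hlip (s := Finset.range i) hρ (fun j hj => ?_) ?_
    · rw [Finset.mem_range] at hj
      simp [hz, mixCoord, hj]
    · refine le_of_eq_of_le (Finset.sum_congr rfl fun j hj => ?_) hw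
      rw [Finset.mem_range] at hj
      simp [hz, mixCoord, hj]
  have h3 := abs_sub_le (f (mixCoord (i + 1) y x)) (f (Function.update z i (y i)))
    (f (mixCoord i y x))
  have h4 := abs_sub_le (f (Function.update z i (y i))) (f z) (f (mixCoord i y x))
  linarith

end LipschitzDistP

theorem ofReal_coeff_mul_eq_one {q ε ω : ℝ} (hε : 0 < ε) (hω : 0 < ω) (i : ℕ) :
    ENNReal.ofReal ((2 : ℝ) ^ ((i : ℝ) ^ 2 + q * i) / (ω * ε ^ ((i : ℝ) + q))) *
      (ENNReal.ofReal (ε / 2 ^ i) ^ q *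
        (ENNReal.ofReal ((ε / 2 ^ i) ^ i) * ENNReal.ofReal ω)) = 1 := by
  rw [ENNReal.ofReal_rpow_of_pos (by positivity), ← ENNReal.ofReal_mul (by positivity),
    ← ENNReal.ofReal_mul (by positivity), ← ENNReal.ofReal_mul (by positivity),
    ← ENNReal.ofReal_one]
  congr 1
  have h1 : (2 : ℝ) ^ ((i : ℝ) ^ 2 + q * i) = (2 ^ i) ^ i * (2 ^ i) ^ q := by
    rw [Real.rpow_add two_pos, ← pow_mul, ← Real.rpow_natCast 2 i, ← Real.rpow_mul two_pos.le,
      mul_comm q, ← Real.rpow_natCast 2 (i * i)]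
    push_cast
    rw [sq]
  have h2 : ε ^ ((i : ℝ) + q) = ε ^ i * ε ^ q := by
    rw [Real.rpow_add hε, Real.rpow_natCast]
  rw [h1, h2, Real.div_rpow hε.le (by positivity), div_pow]
  have : 0 < ε ^ q := by positivity
  have : (0 : ℝ) < (2 ^ i) ^ q := by positivity
  field_simp

/-- A point of the `ℓ_p`-ball around `y` at which the average `G` is small exists as soon as the
integral of `G` is smaller than its integral over the ball would otherwise have to be. -/
theorem exists_sum_norm_sub_rpow_le_and_le {p q ε : ℝ} (hp : 1 < p) (hε0 : 0 < ε)
    (hε : ε < 1 / 2) (i : ℕ) {G : InfTorus → ℝ≥0∞}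
    (hG : ENNReal.ofReal
        ((2 : ℝ) ^ ((i : ℝ) ^ 2 + q * i) / (lpBallVolume i p * ε ^ ((i : ℝ) + q))) *
      ∫⁻ w, G w ∂torusMeasure < 1) (y : InfTorus) :
    ∃ w : InfTorus, ∑ j ∈ Finset.range i, ‖w j - y j‖ ^ p ≤ (ε / 2 ^ i) ^ p ∧
      G w ≤ ENNReal.ofReal (ε / 2 ^ i) ^ q := by
  by_contra! hcon
  refine hG.not_ge ?_
  have hr : ε / 2 ^ i < 1 / 2 :=
    (div_le_self hε0.le (one_le_pow₀ one_le_two)).trans_lt hε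
  rw [← ofReal_coeff_mul_eq_one (q := q) hε0 (lpBallVolume_pos hp i) i]
  gcongr
  set B := {w : InfTorus | ∑ j ∈ Finset.range i, ‖w j - y j‖ ^ p ≤ (ε / 2 ^ i) ^ p}
  calc _ ≤ ENNReal.ofReal (ε / 2 ^ i) ^ q * torusMeasure B := by
        gcongr
        exact le_torusMeasure_sum_norm_sub_rpow_le hp i (by positivity) hr y
    _ = ∫⁻ _ in B, ENNReal.ofReal (ε / 2 ^ i) ^ q ∂torusMeasure := (setLIntegral_const _ _).symm
    _ ≤ ∫⁻ w in B, G w ∂torusMeasure :=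
        setLIntegral_mono' (measurableSet_sum_norm_sub_rpow_le p i _ y) fun w hw => (hcon w hw).le
    _ ≤ ∫⁻ w, G w ∂torusMeasure := setLIntegral_le_lintegral _ _

/-- The average of `h` over the torus spanned by the first `n + 1` coordinate circles through
`x`, written as an iterated integral. -/
def fiberAverage (n : ℕ) (h : InfTorus → ℝ≥0∞) (x : InfTorus) : ℝ≥0∞ :=
  ∫⁻ w, (∫⁻ t : AddCircle (1 : ℝ), h (mixCoord n w x + Pi.single n t)) ∂torusMeasure

theorem aemeasurable_fiberAverage (n : ℕ) {h : InfTorus → ℝ≥0∞}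
    (hh : AEMeasurable h torusMeasure) : AEMeasurable (fiberAverage n h) torusMeasure :=
  (hh.comp_quasiMeasurePreserving
    (measurePreserving_mixCoord_add_single n).quasiMeasurePreserving).lintegral_prod_right'
    |>.lintegral_prod_right'

theorem lintegral_fiberAverage (n : ℕ) {h : InfTorus → ℝ≥0∞}
    (hh : AEMeasurable h torusMeasure) :
    ∫⁻ x, fiberAverage n h x ∂torusMeasure = ∫⁻ x, h x ∂torusMeasure := by
  have hmp := measurePreserving_mixCoord_add_single n
  have hm := hh.comp_quasiMeasurePreserving hmp.quasiMeasurePreserving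
  have h1 := lintegral_prod _ hm.lintegral_prod_right'
  have h2 := lintegral_prod _ hm
  simp only [Function.comp_apply] at h1 h2
  simp only [fiberAverage]
  rw [← h1, ← h2, ← lintegral_map' (hmp.map_eq.symm ▸ hh) hmp.aemeasurable, hmp.map_eq]

theorem exists_forall_fiberAverage_lt_one {c : ℕ → ℝ≥0∞} {h : ℕ → InfTorus → ℝ≥0∞}
    (hh : ∀ i, AEMeasurable (h i) torusMeasure)
    (hint : ∫⁻ x, ∑' i, c i * h i x ∂torusMeasure < 1) {P : InfTorus → Prop}
    (hP : ∀ᵐ x ∂torusMeasure, P x) :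
    ∃ x, P x ∧ ∀ i, c i * fiberAverage i (h i) x < 1 := by
  have heq : ∫⁻ x, ∑' i, c i * fiberAverage i (h i) x ∂torusMeasure =
      ∫⁻ x, ∑' i, c i * h i x ∂torusMeasure := by
    rw [lintegral_tsum fun i => (hh i).const_mul _,
      lintegral_tsum fun i => (aemeasurable_fiberAverage i (hh i)).const_mul _]
    refine tsum_congr fun i => ?_
    rw [lintegral_const_mul'' _ (hh i),
      lintegral_const_mul'' _ (aemeasurable_fiberAverage i (hh i)), lintegral_fiberAverage i (hh i)]
  have hfreq : ∃ᶠ x in ae torusMeasure, ¬ 1 ≤ ∑' i, c i * fiberAverage i (h i) x := by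
    intro hcon
    simp only [not_not] at hcon
    have := lintegral_mono_ae hcon
    rw [heq, lintegral_one, measure_univ] at this
    exact hint.not_ge this
  obtain ⟨x, hx, hPx⟩ := (hfreq.and_eventually hP).exists
  exact ⟨x, hPx, fun i => (ENNReal.le_tsum i).trans_lt (not_le.1 hx)⟩

theorem essOsc_le_of_ae_abs_sub_le {μ : Measure InfTorus} [SFinite μ] {f : InfTorus → ℝ} {a r : ℝ}
    (h : ∀ᵐ y ∂μ, |f y - a| ≤ r) : essOsc μ f ≤ ENNReal.ofReal (2 * r) := by
  refine essSup_le_of_ae_le _ ?_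
  filter_upwards [Measure.quasiMeasurePreserving_fst.ae h, Measure.quasiMeasurePreserving_snd.ae h]
    with z h1 h2
  refine ENNReal.ofReal_le_ofReal ?_
  have := abs_sub_le (f z.1) a (f z.2)
  rw [abs_sub_comm a] at this
  linarith

/-- Let `1 < p < ∞`, `q = p/(p-1)`, `0 < ε < 1/2`, and let `f : 𝕋^∞ → ℝ`
be measurable and `1`-Lipschitz w.r.t. `dist_p`. If
`∫ ∑ᵢ c_{ε,p,i} |∂f/∂x_i|^q dσ ≤ 1/2`, where (with Lean's `0`-indexed coordinate `i`
corresponding to the paper's coordinate `i+1`) `c_{ε,p,i} = 2^(i²+qi)/(ω_{i,p} ε^(i+q))`,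
then `essosc(f;𝕋^∞) < 8ε`. -/
theorem essOsc_lt_of_lintegral_deriv_le (p q ε : ℝ) (hp : 1 < p) (hq : q = p / (p - 1))
    (hε0 : 0 < ε) (hε : ε < 1 / 2) (f : InfTorus → ℝ)
    (hmeas : AEMeasurable f torusMeasure)
    (hlip : ∀ x y : InfTorus, distP p x y ≠ ∞ → |f x - f y| ≤ (distP p x y).toReal)
    (hint : ∫⁻ x, ∑' i : ℕ,
        ENNReal.ofReal ((2 : ℝ) ^ ((i : ℝ) ^ 2 + q * i) / (lpBallVolume i p * ε ^ ((i : ℝ) + q)))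
          * ENNReal.ofReal |pderivInf f i x| ^ q ∂torusMeasure ≤ 1 / 2) :
    essOsc torusMeasure f < ENNReal.ofReal (8 * ε) := by
  have hq1 : 1 ≤ q := by
    rw [hq, le_div_iff₀ (by linarith)]
    linarith
  have harctan : MemLp (fun x => Real.arctan (f x)) 1 torusMeasure :=
    .of_bound (Real.measurable_arctan.comp_aemeasurable hmeas).aestronglyMeasurable (Real.pi / 2)
      (.of_forall fun x => (abs_le.2
        ⟨(Real.neg_pi_div_two_lt_arctan _).le, (Real.arctan_lt_pi_div_two _).le⟩))
  obtain ⟨ns, hns⟩ := exists_seq_tendsto_comp_mixCoord harctan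
  obtain ⟨x, hx, hlt⟩ := exists_forall_fiberAverage_lt_one
    (fun i => ((aemeasurable_pderivInf hp hmeas hlip i).abs.ennreal_ofReal.pow_const q))
    (hint.trans_lt (by simp)) (Measure.ae_ae_of_ae_prod hns)
  have hstep (y : InfTorus) (i : ℕ) : |f (mixCoord (i + 1) y x) - f (mixCoord i y x)| ≤
      2 * (if i = 0 then 0 else ε / 2 ^ i) + ε / 2 ^ i / 2 := by
    obtain ⟨w, hw, hGw⟩ := exists_sum_norm_sub_rpow_le_and_le hp hε0 hε i (hlt i) y
    refine abs_sub_mixCoord_succ_le hp hq1 hlip (by split_ifs <;> positivity) (by positivity)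
      ?_ hGw
    split_ifs with hi
    · simp [hi, Real.zero_rpow (by linarith : p ≠ 0)]
    · exact hw
  have hbound (y : InfTorus) (n : ℕ) :
      |f (mixCoord (n + 1) y x) - f x| ≤ 3 * ε - 5 / 2 * (ε / 2 ^ n) := by
    induction n with
    | zero =>
      have := hstep y 0
      have h0 : mixCoord 0 y x = x := by ext; simp [mixCoord]
      rw [h0] at this
      norm_num at this ⊢
      linarith
    | succ n ih =>
      have := hstep y (n + 1)
      rw [if_neg n.succ_ne_zero, pow_succ, ← div_div] at this
      rw [pow_succ, ← div_div]
      have := abs_sub_le (f (mixCoord (n + 1 + 1) y x)) (f (mixCoord (n + 1) y x)) (f x)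
      linarith
  have hbound' (y : InfTorus) (n : ℕ) : |f (mixCoord n y x) - f x| ≤ 3 * ε := by
    rcases n with _ | n
    · have h0 : mixCoord 0 y x = x := by ext; simp [mixCoord]
      rw [h0, sub_self, abs_zero]
      positivity
    · have : 0 < ε / 2 ^ n := by positivity
      linarith [hbound y n]
  have hae : ∀ᵐ y ∂torusMeasure, |f y - f x| ≤ 3 * ε := by
    filter_upwards [hx] with y hy
    have hb k := abs_le.1 (hbound' y (ns k))
    have h1 := ge_of_tendsto' hy fun k =>
      Real.arctan_strictMono.monotone (by linarith [(hb k).1] : f x - 3 * ε ≤ _)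
    have h2 := le_of_tendsto' hy fun k =>
      Real.arctan_strictMono.monotone (by linarith [(hb k).2] : _ ≤ f x + 3 * ε)
    rw [Real.arctan_strictMono.le_iff_le] at h1 h2
    exact abs_le.2 ⟨by linarith, by linarith⟩
  refine (essOsc_le_of_ae_abs_sub_le hae).trans_lt
    ((ENNReal.ofReal_lt_ofReal_iff (by positivity)).2 (by linarith))
end
end
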